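/- Let A ∈ ℂ^{n×n} be a normal matrix and let f, φ₁, …, φ_k ∈ ℂ[X] be polynomials. Then the supremum over all unit vectors v ∈ ℂⁿ of the infimum over all coefficients α₁, …, α_k ∈ ℂ of ‖f(A)v − Σ_{i=1}^k αᵢφᵢ(A)v‖ equals the infimum over all α₁, …, α_k ∈ ℂ of ‖f(A) − Σ_{i=1}^k αᵢφᵢ(A)‖, where the vector norm is the Euclidean norm on ℂⁿ, the matrix norm is the spectral norm, and p(A) denotes the evaluation of the polynomial p at the matrix A. -/

import Mathlib

open Matrix Polynomial

open ComplexStarModule in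
/-- Spectral theorem: a normal operator has an orthonormal basis of eigenvectors. -/
theorem ContinuousLinearMap.exists_orthonormalBasis_apply_eq_smul_of_isStarNormal
    {E : Type*} [NormedAddCommGroup E] [InnerProductSpace ℂ E] [FiniteDimensional ℂ E]
    [CompleteSpace E] {n : ℕ} (hn : Module.finrank ℂ E = n) (T : E →L[ℂ] E) [hT : IsStarNormal T] :
    ∃ (b : OrthonormalBasis (Fin n) ℂ E) (μ : Fin n → ℂ), ∀ j, T (b j) = μ j • b j := by
  classical
  set H : E →L[ℂ] E := (ℜ T : E →L[ℂ] E)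
  set K : E →L[ℂ] E := (ℑ T : E →L[ℂ] E)
  have hHK : Commute H K := isStarNormal_iff_commute_realPart_imaginaryPart.mp hT
  have hTHK : T = H + Complex.I • K := (realPart_add_I_smul_imaginaryPart T).symm
  have hHs : (H : E →ₗ[ℂ] E).IsSymmetric := (ℜ T).2.isSymmetric
  have hKs : (K : E →ₗ[ℂ] E).IsSymmetric := (ℑ T).2.isSymmetric
  have hc : Commute (H : E →ₗ[ℂ] E) (K : E →ₗ[ℂ] E) :=
    congrArg (fun S : E →L[ℂ] E => (S : E →ₗ[ℂ] E)) hHK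
  have hV₀ := hHs.directSum_isInternal_of_commute hKs hc
  have := hV₀.submodule_iSupIndep.fintypeNeBotOfFiniteDimensional
  have hV := DirectSum.isInternal_ne_bot_iff.mpr hV₀
  have hV' := (hHs.orthogonalFamily_eigenspace_inf_eigenspace hKs).comp
    (Subtype.val_injective (p := fun i => Module.End.eigenspace (H : E →ₗ[ℂ] E) i.2 ⊓
      Module.End.eigenspace (K : E →ₗ[ℂ] E) i.1 ≠ ⊥))
  refine ⟨hV.subordinateOrthonormalBasis hn hV', fun j =>
    (hV.subordinateOrthonormalBasisIndex hn j hV').1.2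
      + Complex.I * (hV.subordinateOrthonormalBasisIndex hn j hV').1.1, fun j => ?_⟩
  obtain ⟨h1, h2⟩ := hV.subordinateOrthonormalBasis_subordinate hn j hV'
  have h1 := Module.End.mem_eigenspace_iff.mp h1
  have h2 := Module.End.mem_eigenspace_iff.mp h2
  simp only [ContinuousLinearMap.coe_coe] at h1 h2
  rw [hTHK, _root_.add_apply, _root_.smul_apply, h1, h2,
    add_smul, mul_smul]

/-- Parseval's identity for an operator that is diagonal in an orthonormal basis. -/
theorem OrthonormalBasis.norm_sq_apply_of_diagonal
    {ι E : Type*} [Fintype ι] [NormedAddCommGroup E] [InnerProductSpace ℂ E]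
    (b : OrthonormalBasis ι ℂ E) (S : E →L[ℂ] E) (c : ι → ℂ) (hS : ∀ j, S (b j) = c j • b j)
    (v : E) :
    ‖S v‖ ^ 2 = ∑ j, ‖inner ℂ (b j) v‖ ^ 2 * ‖c j‖ ^ 2 := by
  classical
  have h : ∀ j, inner ℂ (b j) (S v) = c j * inner ℂ (b j) v := by
    intro j
    conv_lhs => rw [← b.sum_repr v]
    simp [map_sum, hS, b.inner_eq_ite, b.repr_apply_apply, mul_comm]
  rw [← b.sum_sq_norm_inner_right (S v)]
  exact Finset.sum_congr rfl fun j _ => by rw [h, norm_mul]; ring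

/-- Minimax for a finite family of continuous convex functions: if every weighted average takes
a value below `r`, then some point makes all the weighted averages less than `r`. -/
theorem exists_forall_mem_stdSimplex_sum_lt
    {ι F : Type*} [Fintype ι] [Nonempty ι] [TopologicalSpace F] [AddCommGroup F] [Module ℝ F]
    [IsTopologicalAddGroup F] [ContinuousSMul ℝ F]
    (g : ι → F → ℝ) (hg : ∀ j, ConvexOn ℝ Set.univ (g j)) (hc : ∀ j, Continuous (g j)) {r : ℝ}
    (h : ∀ w ∈ stdSimplex ℝ ι, ∃ y, ∑ j, w j * g j y < r) :
    ∃ y, ∀ w ∈ stdSimplex ℝ ι, ∑ j, w j * g j y < r := by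
  classical
  have hcw : ∀ y, Continuous fun w : ι → ℝ => ∑ j, w j * g j y := fun y => by fun_prop
  obtain ⟨s, -, hs, hsub⟩ := (isCompact_stdSimplex ℝ ι).elim_finite_subcover_image
    (b := Set.univ) (c := fun y : F => {w : ι → ℝ | ∑ j, w j * g j y < r})
    (fun y _ => isOpen_lt (hcw y) continuous_const)
    (fun w hw => by simpa using h w hw)
  obtain ⟨y, -, hy⟩ := Sion.exists_lt_iInf_of_lt_iInf_of_finite
    (X := stdSimplex ℝ ι) (Y := (Set.univ : Set F)) (f := fun w y => -∑ j, w j * g j y)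
    (t := -r) ⟨_, single_mem_stdSimplex ℝ (Classical.arbitrary ι)⟩ (isCompact_stdSimplex ℝ ι)
    (fun y _ => (hcw y).neg.lowerSemicontinuous.lowerSemicontinuousOn _)
    (fun y _ => by
      refine ConvexOn.quasiconvexOn ⟨convex_stdSimplex ℝ ι, fun w _ w' _ a a' _ _ _ => le_of_eq ?_⟩
      simp only [Pi.add_apply, Pi.smul_apply, smul_eq_mul, mul_neg, Finset.mul_sum, ← neg_add,
        ← Finset.sum_add_distrib]
      congr 1
      exact Finset.sum_congr rfl fun j _ => by ring)
    convex_univ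
    (fun w _ => (show Continuous fun y => -∑ j, w j * g j y by
      fun_prop).upperSemicontinuous.upperSemicontinuousOn _)
    (fun w hw => by
      refine ConcaveOn.quasiconcaveOn (ConvexOn.neg ?_)
      refine ⟨convex_univ, fun y _ y' _ a a' ha ha' haa' => ?_⟩
      simp only [smul_eq_mul, Finset.mul_sum, ← Finset.sum_add_distrib]
      refine Finset.sum_le_sum fun j _ => ?_
      refine (mul_le_mul_of_nonneg_left
        ((hg j).2 (Set.mem_univ y) (Set.mem_univ y') ha ha' haa') (hw.1 j)).trans_eq ?_
      simp only [smul_eq_mul]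
      ring)
    (convex_stdSimplex ℝ ι) hs (Set.subset_univ _)
    (fun w hw => by simpa using hsub hw)
  exact ⟨y, fun w hw => neg_lt_neg_iff.mp (hy w hw)⟩

/-- Max-min equals min-max for a normal complex matrix and matrix functions
given by polynomials `f, φ₁, …, φ_k`. -/
theorem maxmin_eq_minmax_normal_polynomials_complex
    (n k : ℕ) (A : Matrix (Fin n) (Fin n) ℂ) (hA : Aᴴ * A = A * Aᴴ)
    (f : Polynomial ℂ) (φ : Fin k → Polynomial ℂ) :
    (⨆ v : {v : EuclideanSpace ℂ (Fin n) // ‖v‖ = 1},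
      ⨅ α : Fin k → ℂ,
        ‖Matrix.toEuclideanCLM (𝕜 := ℂ) (aeval A f) v.1
          - ∑ i : Fin k, α i • Matrix.toEuclideanCLM (𝕜 := ℂ) (aeval A (φ i)) v.1‖)
    = ⨅ α : Fin k → ℂ,
        ‖Matrix.toEuclideanCLM (𝕜 := ℂ) (aeval A f - ∑ i : Fin k, α i • aeval A (φ i))‖ := by
  set S : (Fin k → ℂ) → EuclideanSpace ℂ (Fin n) →L[ℂ] EuclideanSpace ℂ (Fin n) := fun α =>
    Matrix.toEuclideanCLM (𝕜 := ℂ) (aeval A f - ∑ i : Fin k, α i • aeval A (φ i)) with hS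
  have hSv : ∀ α v, Matrix.toEuclideanCLM (𝕜 := ℂ) (aeval A f) v
      - ∑ i : Fin k, α i • Matrix.toEuclideanCLM (𝕜 := ℂ) (aeval A (φ i)) v = S α v := by
    intro α v
    simp [hS]
  simp only [hSv]
  have hbv : ∀ v, BddBelow (Set.range fun α => ‖S α v‖) := fun v =>
    ⟨0, by rintro _ ⟨α, rfl⟩; positivity⟩
  have hb : BddBelow (Set.range fun α => ‖S α‖) := ⟨0, by rintro _ ⟨α, rfl⟩; positivity⟩
  have hle : ∀ v : {v : EuclideanSpace ℂ (Fin n) // ‖v‖ = 1},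
      ⨅ α, ‖S α v.1‖ ≤ ⨅ α, ‖S α‖ := fun v => ciInf_mono (hbv _) fun α => by
    simpa [v.2] using (S α).le_opNorm v.1
  rcases Nat.eq_zero_or_pos n with rfl | hn
  · have : IsEmpty {v : EuclideanSpace ℂ (Fin 0) // ‖v‖ = 1} :=
      ⟨fun v => by simpa [Subsingleton.elim v.1 0] using v.2⟩
    have h0 : ∀ α, S α = 0 := fun α => Subsingleton.elim _ _
    simp [h0]
  have : Nonempty (Fin n) := ⟨⟨0, hn⟩⟩
  have : Nonempty {v : EuclideanSpace ℂ (Fin n) // ‖v‖ = 1} :=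
    ⟨⟨EuclideanSpace.single ⟨0, hn⟩ 1, by simp⟩⟩
  refine le_antisymm (ciSup_le hle) (le_of_forall_gt_imp_ge_of_dense fun r hr => ?_)
  have hbs : BddAbove (Set.range fun v : {v : EuclideanSpace ℂ (Fin n) // ‖v‖ = 1} =>
      ⨅ α, ‖S α v.1‖) := ⟨_, by rintro _ ⟨v, rfl⟩; exact hle v⟩
  have hr0 : 0 < r :=
    (Real.iSup_nonneg fun v => Real.iInf_nonneg fun α => norm_nonneg _).trans_lt hr
  set T := Matrix.toEuclideanCLM (𝕜 := ℂ) A with hT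
  have : IsStarNormal T :=
    ⟨by rw [hT, ← map_star]; exact (show Commute (star A) A from hA).map _⟩
  obtain ⟨b, μ, hbμ⟩ :=
    T.exists_orthonormalBasis_apply_eq_smul_of_isStarNormal (finrank_euclideanSpace_fin (𝕜 := ℂ))
  have haev : ∀ (p : ℂ[X]) j, Matrix.toEuclideanCLM (𝕜 := ℂ) (aeval A p) (b j)
      = p.eval (μ j) • b j := by
    intro p j
    induction p using Polynomial.induction_on with
    | C a => simp [Algebra.algebraMap_eq_smul_one]
    | add p q hp hq => simp [hp, hq, add_smul]
    | monomial m a ih =>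
      rw [pow_succ, ← mul_assoc, map_mul, aeval_X, map_mul, mul_apply_eq_comp, hbμ,
        map_smul, ih, smul_smul, eval_mul_X, mul_comm]
  set c : Fin n → (Fin k → ℂ) → ℂ := fun j α =>
    f.eval (μ j) - ∑ i, α i * (φ i).eval (μ j) with hcdef
  have hdiag : ∀ α j, S α (b j) = c j α • b j := by
    intro α j
    rw [← hSv]
    simp [haev, hcdef, sub_smul, Finset.sum_smul, mul_smul]
  have hnorm := fun α => b.norm_sq_apply_of_diagonal (S α) (c · α) (hdiag α)
  obtain ⟨α, hα⟩ := exists_forall_mem_stdSimplex_sum_lt (fun j α => ‖c j α‖ ^ 2) (r := r ^ 2)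
    (fun j => by
      refine ⟨convex_univ, fun α _ β _ s t hs ht hst => ?_⟩
      have hc : c j (s • α + t • β) = s • c j α + t • c j β := by
        have hst' : (s : ℂ) + t = 1 := by exact_mod_cast hst
        simp only [hcdef, Pi.add_apply, Pi.smul_apply, Complex.real_smul, add_mul, mul_assoc,
          Finset.sum_add_distrib, ← Finset.mul_sum]
        linear_combination -(f.eval (μ j)) * hst'
      simp only [hc]
      exact (convexOn_univ_norm.pow (fun _ _ => norm_nonneg _) 2).2 trivial trivial hs ht hst)
    (fun j => by fun_prop)
    (fun w hw => by
      set v := ∑ j, (Real.sqrt (w j) : ℂ) • b j with hv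
      have hin : ∀ j, ‖inner ℂ (b j) v‖ ^ 2 = w j := by
        intro j
        simp [hv, b.inner_eq_ite, Real.sq_sqrt (hw.1 j)]
      have hv1 : ‖v‖ = 1 := by
        have := b.sum_sq_norm_inner_right v
        simp only [hin, hw.2] at this
        exact (pow_eq_one_iff_of_nonneg (norm_nonneg _) two_ne_zero).mp this.symm
      obtain ⟨α, hα⟩ := exists_lt_of_ciInf_lt ((le_ciSup hbs ⟨v, hv1⟩).trans_lt hr)
      refine ⟨α, ?_⟩
      have := hnorm α v
      simp only [hin] at this
      rw [← this]
      gcongr)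
  refine (ciInf_le hb α).trans ((S α).opNorm_le_of_unit_norm hr0.le fun v hv => ?_)
  refine le_of_sq_le_sq ?_ hr0.le
  rw [hnorm]
  refine (hα (fun j => ‖inner ℂ (b j) v‖ ^ 2) ⟨fun j => by positivity, ?_⟩).le
  rw [b.sum_sq_norm_inner_right, hv, one_pow]
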